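/- arXiv:2305.03946 — 2 statements merged into one kernel-verified Lean document; each statement's English description precedes it below -/
import Mathlib

section
/- There exists a constant C ∈ ℕ (independent of r, P, T, S and p) such that the following holds: if S is an optimal solution and p ∈ P is a station, then the number of sensors s ∈ S such that dist(s, p) ≤ r/2 and p is a nearest station to s (i.e., dist(s, p) ≤ dist(s, p') for all p' ∈ P) is at most C. -/
/-- The set of points covered by a finite set `S` of sensors with sensing
radius `r` includes every target: for each `t ∈ T` there is `s ∈ S` with
`dist s t ≤ r`. -/
def Covers (r : ℝ) (T : Set (EuclideanSpace ℝ (Fin 2)))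
    (S : Finset (EuclideanSpace ℝ (Fin 2))) : Prop :=
  ∀ t ∈ T, ∃ s ∈ S, dist s t ≤ r

/-- The total moving cost of a sensor set `S`: each sensor moves from its
nearest station in `P`. -/
noncomputable def cost (P S : Finset (EuclideanSpace ℝ (Fin 2))) : ℝ :=
  ∑ s ∈ S, Metric.infDist s (P : Set (EuclideanSpace ℝ (Fin 2)))

/-- `S` is an optimal solution: it covers `T` and has minimum cost among all
finite sensor sets covering `T`. -/
def Optimal (r : ℝ) (P : Finset (EuclideanSpace ℝ (Fin 2)))
    (T : Set (EuclideanSpace ℝ (Fin 2)))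
    (S : Finset (EuclideanSpace ℝ (Fin 2))) : Prop :=
  Covers r T S ∧
    ∀ S' : Finset (EuclideanSpace ℝ (Fin 2)), Covers r T S' → cost P S ≤ cost P S'

set_option maxHeartbeats 1000000 in
/-- Plane geometry behind the exchange of two sensors in almost the same direction: a point of the
disc around the shorter sensor which is missed by the discs around the origin and around the longer
sensor is reached by a short sensor moved perpendicularly to the longer one. -/
lemma perpendicular_disc_bound {r a b c d X Y : ℝ} (hr : 0 < r) (hb : 0 < b) (hba : b ≤ a / 20)
    (ha : a ≤ r / 2) (hcd : c ^ 2 + d ^ 2 = 1) (hc : 1 - 1 / 800 ≤ c)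
    (h0 : r ^ 2 < X ^ 2 + Y ^ 2) (h1 : r ^ 2 < (X - a) ^ 2 + Y ^ 2)
    (h2 : (X - b * c) ^ 2 + (Y - b * d) ^ 2 ≤ r ^ 2) :
    X ^ 2 + (|Y| - 9 * b / 20) ^ 2 ≤ r ^ 2 := by
  have hc1 : c ≤ 1 := by nlinarith [sq_nonneg d]
  have hd : |d| ≤ 1 / 20 := abs_le_of_sq_le_sq (by nlinarith) (by norm_num)
  have ha0 : 0 < a := by linarith
  have hX : X ≤ 3 / 2 * r := by
    have h := abs_le.mp (abs_le_of_sq_le_sq (a := X - b * c) (b := r)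
      (by nlinarith [sq_nonneg (Y - b * d)]) hr.le)
    nlinarith [h.2]
  have hY : |Y| ≤ 3 / 2 * r := by
    have h := abs_le.mp (abs_le_of_sq_le_sq (a := Y - b * d) (b := r)
      (by nlinarith [sq_nonneg (X - b * c)]) hr.le)
    have hd' := abs_le.mp hd
    exact abs_le.mpr ⟨by nlinarith [h.1], by nlinarith [h.2]⟩
  have hdY : |d * Y| ≤ |Y| / 20 := by
    rw [abs_mul]; nlinarith [abs_nonneg Y]
  have hdY' := abs_le.mp hdY
  have hcX : c * X ≤ 3 / 2 * r := by nlinarith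
  obtain ⟨ρ, hρ⟩ : ∃ ρ, ρ = X ^ 2 + Y ^ 2 - r ^ 2 := ⟨_, rfl⟩
  have hρ0 : 0 < ρ := by linarith
  have h1' : 2 * a * X < ρ + a ^ 2 := by nlinarith
  have h2' : ρ + b ^ 2 ≤ 2 * b * (c * X + d * Y) := by
    have : b ^ 2 * (c ^ 2 + d ^ 2) = b ^ 2 := by rw [hcd, mul_one]
    nlinarith
  have hρ1 : ρ ≤ 2 * b * (8 / 5 * r) := by
    have : c * X + d * Y ≤ 8 / 5 * r := by linarith
    nlinarith [sq_nonneg b]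
  have hXu : X ≤ 33 / 100 * r := by
    have : a * X ≤ a * (33 / 100 * r) := by nlinarith
    exact le_of_mul_le_mul_left this ha0
  have hXl : -(r / 10) ≤ X := by
    have : 0 < c * X + d * Y := by
      by_contra! h
      nlinarith [sq_nonneg b]
    by_contra! h
    nlinarith
  have hYl : 9 / 10 * r ≤ |Y| := by
    by_contra! h
    have hYY : |Y| ^ 2 ≤ (9 / 10 * r) ^ 2 := pow_le_pow_left₀ (abs_nonneg Y) h.le 2
    have hXX : X ^ 2 ≤ (33 / 100 * r) ^ 2 := sq_le_sq' (by linarith) hXu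
    rw [sq_abs] at hYY
    linarith [pow_pos hr 2]
  have hbX : 2 * b * X ≤ ρ / 20 + a * b := by
    have : a * (2 * b * X) ≤ a * (ρ / 20 + a * b) := by
      linarith [mul_le_mul_of_nonneg_left h1'.le hb.le, mul_le_mul_of_nonneg_right hba hρ0.le]
    exact le_of_mul_le_mul_left this ha0
  have hbcX : 2 * b * (c * X) ≤ ρ / 20 + a * b := by
    have h0 : 0 ≤ ρ / 20 + a * b := by positivity
    rcases le_total X 0 with hX0 | hX0
    · have : b * (c * X) ≤ 0 :=
        mul_nonpos_of_nonneg_of_nonpos hb.le (mul_nonpos_of_nonneg_of_nonpos (by linarith) hX0)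
      linarith
    · have : b * (c * X) ≤ b * X :=
        mul_le_mul_of_nonneg_left (mul_le_of_le_one_left hX0 hc1) hb.le
      linarith
  have hbdY : 2 * b * (d * Y) ≤ b * (|Y| / 10) := by nlinarith
  have key : b * (a + |Y| / 10 + b / 5) ≤ b * (17 / 20 * |Y|) :=
    mul_le_mul_of_nonneg_left (by linarith) hb.le
  nlinarith [sq_abs Y]

lemma EuclideanSpace.dist_le_iff_fin_two {x y : EuclideanSpace ℝ (Fin 2)} {r : ℝ} (hr : 0 ≤ r) :
    dist x y ≤ r ↔ (x 0 - y 0) ^ 2 + (x 1 - y 1) ^ 2 ≤ r ^ 2 := by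
  rw [EuclideanSpace.dist_eq, Real.sqrt_le_left hr]
  simp [Fin.sum_univ_two, Real.dist_eq, sq_abs]

lemma EuclideanSpace.norm_sq_fin_two (x : EuclideanSpace ℝ (Fin 2)) :
    ‖x‖ ^ 2 = x 0 ^ 2 + x 1 ^ 2 := by
  simp [EuclideanSpace.norm_sq_eq, Fin.sum_univ_two, sq_abs]

/-- Removing the sensors `B` from an optimal solution and adding `N` does not lower the cost. -/
lemma Optimal.cost_le_of_exchange {r : ℝ} {P S B N : Finset (EuclideanSpace ℝ (Fin 2))}
    {T : Set (EuclideanSpace ℝ (Fin 2))} (h : Optimal r P T S) (hB : B ⊆ S)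
    (hN : ∀ x, ∀ s ∈ B, dist s x ≤ r → ∃ s' ∈ S \ B ∪ N, dist s' x ≤ r) :
    cost P B ≤ cost P N := by
  classical
  have hle := h.2 (S \ B ∪ N) fun t ht => by
    obtain ⟨s, hs, hst⟩ := h.1 t ht
    by_cases hsB : s ∈ B
    · exact hN t s hsB hst
    · exact ⟨s, by simp [hs, hsB], hst⟩
  have hsplit : cost P (S \ B) + cost P B = cost P S := Finset.sum_sdiff hB
  have hunion : cost P (S \ B ∪ N) ≤ cost P (S \ B) + cost P N := by
    unfold cost
    rw [← Finset.sum_union_inter]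
    exact le_add_of_nonneg_right (Finset.sum_nonneg fun _ _ => Metric.infDist_nonneg)
  linarith

/-- Adding the station `p` itself is free, and any other sensor costs at most its distance
to `p`. -/
lemma cost_insert_image_le [DecidableEq (EuclideanSpace ℝ (Fin 2))]
    {P : Finset (EuclideanSpace ℝ (Fin 2))} {p : EuclideanSpace ℝ (Fin 2)} (hp : p ∈ P)
    {ι : Type*} (W : Finset ι) (f : ι → EuclideanSpace ℝ (Fin 2)) {k : ℝ} (hk : 0 ≤ k)
    (hf : ∀ w ∈ W, dist (f w) p ≤ k) :
    cost P (insert p (W.image f)) ≤ W.card * k := by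
  unfold cost
  rw [Finset.sum_insert_zero (a := p) (Metric.infDist_zero_of_mem (Finset.mem_coe.2 hp))]
  refine (Finset.sum_le_card_nsmul _ _ k fun s hs => ?_).trans ?_
  · obtain ⟨w, hw, rfl⟩ := Finset.mem_image.1 hs
    exact (Metric.infDist_le_dist_of_mem hp).trans (hf w hw)
  · rw [nsmul_eq_mul]
    exact mul_le_mul_of_nonneg_right (mod_cast Finset.card_image_le) hk

lemma infDist_eq_dist_of_nearest {P : Finset (EuclideanSpace ℝ (Fin 2))}
    {p s : EuclideanSpace ℝ (Fin 2)} (hp : p ∈ P) (h : ∀ p' ∈ P, dist s p ≤ dist s p') :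
    Metric.infDist s (P : Set (EuclideanSpace ℝ (Fin 2))) = dist s p :=
  le_antisymm (Metric.infDist_le_dist_of_mem hp) ((Metric.le_infDist ⟨p, hp⟩).2 fun {_} hy => h _ hy)

/-- In an optimal solution, two sensors near the station `p` and in almost the same direction from
`p` are at comparable distances from `p`. -/
lemma Optimal.dist_lt_of_direction_close {r : ℝ} (hr : 0 < r)
    {P S : Finset (EuclideanSpace ℝ (Fin 2))} {T : Set (EuclideanSpace ℝ (Fin 2))}
    (h : Optimal r P T S) {p s₁ s₂ : EuclideanSpace ℝ (Fin 2)} (hp : p ∈ P) (hs₁ : s₁ ∈ S)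
    (hs₂ : s₂ ∈ S) (h₁ : dist s₁ p ≤ r / 2) (hne : s₂ ≠ p) (hne₁ : s₁ ≠ p)
    (hnear : ∀ p' ∈ P, dist s₂ p ≤ dist s₂ p')
    (hdir : dist (‖s₁ - p‖⁻¹ • (s₁ - p)) (‖s₂ - p‖⁻¹ • (s₂ - p)) ≤ 1 / 20) :
    dist s₁ p < 20 * dist s₂ p := by
  classical
  by_contra! hcon
  rw [dist_eq_norm] at h₁
  rw [dist_eq_norm, dist_eq_norm] at hcon
  obtain ⟨a, ha⟩ : ∃ a, a = ‖s₁ - p‖ := ⟨_, rfl⟩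
  obtain ⟨b, hb⟩ : ∃ b, b = ‖s₂ - p‖ := ⟨_, rfl⟩
  have ha0 : 0 < a := ha ▸ norm_pos_iff.2 (sub_ne_zero.2 hne₁)
  have hb0 : 0 < b := hb ▸ norm_pos_iff.2 (sub_ne_zero.2 hne)
  rw [← ha, ← hb] at hdir hcon
  rw [← ha] at h₁
  obtain ⟨u, hu⟩ : ∃ u, u = a⁻¹ • (s₁ - p) := ⟨_, rfl⟩
  obtain ⟨u', hu'⟩ : ∃ u', u' = b⁻¹ • (s₂ - p) := ⟨_, rfl⟩
  rw [← hu, ← hu', EuclideanSpace.dist_le_iff_fin_two (by norm_num)] at hdir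
  have hun : u 0 ^ 2 + u 1 ^ 2 = 1 := by
    rw [← EuclideanSpace.norm_sq_fin_two, hu, norm_smul, ← ha, norm_inv, Real.norm_of_nonneg ha0.le,
      inv_mul_cancel₀ ha0.ne', one_pow]
  have hun' : u' 0 ^ 2 + u' 1 ^ 2 = 1 := by
    rw [← EuclideanSpace.norm_sq_fin_two, hu', norm_smul, ← hb, norm_inv,
      Real.norm_of_nonneg hb0.le, inv_mul_cancel₀ hb0.ne', one_pow]
  have hs₁u : s₁ = p + a • u := by rw [hu, smul_inv_smul₀ ha0.ne']; abel
  have hs₂u : s₂ = p + b • u' := by rw [hu', smul_inv_smul₀ hb0.ne']; abel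
  let v : EuclideanSpace ℝ (Fin 2) := !₂[-u 1, u 0]
  have hv : ‖v‖ = 1 := by
    have := EuclideanSpace.norm_sq_fin_two v
    have h1 : ‖v‖ ^ 2 = 1 := by
      rw [this]; simp only [v]; simp; linarith
    exact (pow_eq_one_iff_of_nonneg (norm_nonneg v) two_ne_zero).1 h1
  let m := 9 * b / 20
  have hm : 0 ≤ m := by positivity
  have hcost := h.cost_le_of_exchange (B := {s₂})
    (N := insert p (({v, -v} : Finset _).image fun w => p + m • w)) (by simpa using hs₂) (by
      intro x s hs hsx
      obtain rfl := Finset.mem_singleton.1 hs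
      by_cases hx0 : dist p x ≤ r
      · exact ⟨p, by simp, hx0⟩
      by_cases hx1 : dist s₁ x ≤ r
      · refine ⟨s₁, ?_, hx1⟩
        have : s₁ ≠ s := by
          rintro rfl
          linarith [ha.trans hb.symm]
        simp [hs₁, this]
      rw [EuclideanSpace.dist_le_iff_fin_two hr.le] at hx0 hx1 hsx
      rw [hs₁u] at hx1
      rw [hs₂u] at hsx
      simp only [PiLp.add_apply, PiLp.smul_apply, smul_eq_mul, not_le] at hx0 hx1 hsx
      have hgeom := perpendicular_disc_bound (r := r) (a := a) (b := b)
        (c := u 0 * u' 0 + u 1 * u' 1) (d := u 0 * u' 1 - u 1 * u' 0)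
        (X := u 0 * (x 0 - p 0) + u 1 * (x 1 - p 1))
        (Y := u 0 * (x 1 - p 1) - u 1 * (x 0 - p 0)) hr hb0 (by linarith) h₁
        (by linear_combination (u' 0 ^ 2 + u' 1 ^ 2) * hun + hun') (by linarith)
        (by linear_combination hx0 - ((x 0 - p 0) ^ 2 + (x 1 - p 1) ^ 2) * hun)
        (by linear_combination hx1 - ((x 0 - p 0) ^ 2 + (x 1 - p 1) ^ 2 - a ^ 2) * hun)
        (by
          linear_combination hsx + ((x 0 - p 0 - b * u' 0) ^ 2 + (x 1 - p 1 - b * u' 1) ^ 2) * hun)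
      rcases le_total 0 (u 0 * (x 1 - p 1) - u 1 * (x 0 - p 0)) with hY | hY
      · refine ⟨p + m • v, by simp, ?_⟩
        rw [EuclideanSpace.dist_le_iff_fin_two hr.le]
        rw [abs_of_nonneg hY] at hgeom
        simp [v, m]
        linear_combination
          hgeom - ((x 0 - p 0) ^ 2 + (x 1 - p 1) ^ 2 - (9 * b / 20) ^ 2) * hun
      · refine ⟨p + m • -v, by simp, ?_⟩
        rw [EuclideanSpace.dist_le_iff_fin_two hr.le]
        rw [abs_of_nonpos hY] at hgeom
        simp [v, m]
        linear_combination
          hgeom - ((x 0 - p 0) ^ 2 + (x 1 - p 1) ^ 2 - (9 * b / 20) ^ 2) * hun)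
  have hN := cost_insert_image_le hp ({v, -v} : Finset _) (fun w => p + m • w) hm (by
    intro w hw
    have hw : ‖w‖ = 1 := by
      rcases Finset.mem_insert.1 hw with rfl | hw
      · exact hv
      · rw [Finset.mem_singleton.1 hw, norm_neg, hv]
    simp [norm_smul, hw, abs_of_nonneg hm])
  have hcard : ((({v, -v} : Finset (EuclideanSpace ℝ (Fin 2))).card : ℕ) : ℝ) ≤ 2 :=
    mod_cast Finset.card_le_two
  have hB : cost P {s₂} = b := by
    rw [cost, Finset.sum_singleton, infDist_eq_dist_of_nearest hp hnear, dist_eq_norm, hb]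
  have := mul_le_mul_of_nonneg_right hcard hm
  simp only [m] at *
  linarith

/-- A disc of radius `r + l` is covered by the disc of radius `r` and finitely many discs of
radius `r` whose centres have norm `2 * l`, for `l ≤ r / 2`. -/
lemma norm_sub_two_mul_smul_le {E : Type*} [NormedAddCommGroup E] [InnerProductSpace ℝ E]
    {r l : ℝ} (hl : 0 ≤ l) (hlr : l ≤ r / 2) {y w : E} (hw : ‖w‖ = 1) (hr : r < ‖y‖)
    (hy : ‖y‖ ≤ r + l) (hyw : ‖‖y‖⁻¹ • y - w‖ ≤ 1 / 40) : ‖y - (2 * l) • w‖ ≤ r := by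
  have hy0 : 0 < ‖y‖ := by linarith
  have h1 : ‖‖y‖⁻¹ • y - w‖ ^ 2 ≤ (1 / 40) ^ 2 := pow_le_pow_left₀ (norm_nonneg _) hyw 2
  rw [norm_sub_sq_real, norm_smul, norm_inv, norm_norm, inv_mul_cancel₀ hy0.ne', hw,
    real_inner_smul_left] at h1
  have h2 : 99 / 100 * ‖y‖ ≤ inner ℝ y w := by
    have h : 99 / 100 ≤ ‖y‖⁻¹ * inner ℝ y w := by linarith
    rwa [inv_mul_eq_div, le_div_iff₀ hy0] at h
  refine abs_le_of_sq_le_sq' ?_ (by linarith) |>.2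
  rw [norm_sub_sq_real, norm_smul, hw, real_inner_smul_right, Real.norm_of_nonneg (by linarith)]
  nlinarith [mul_le_mul_of_nonneg_left h2 hl, mul_nonneg (sub_nonneg.2 hr.le) (sub_nonneg.2 hy),
    mul_nonneg hl (sub_nonneg.2 hr.le), mul_nonneg hl (sub_nonneg.2 hlr),
    mul_nonneg hl (sub_nonneg.2 hy)]

/-- In an optimal solution, few sensors near the station `p` are at comparable distances
from `p`. -/
lemma Optimal.card_le_of_comparable {r : ℝ} (hr : 0 < r)
    {P S B W : Finset (EuclideanSpace ℝ (Fin 2))} {T : Set (EuclideanSpace ℝ (Fin 2))}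
    (h : Optimal r P T S) {p : EuclideanSpace ℝ (Fin 2)} (hp : p ∈ P) (hBS : B ⊆ S) {l : ℝ}
    (hl : 0 < l) (hlr : l ≤ r / 2) (hub : ∀ s ∈ B, dist s p ≤ l) (hlb : ∀ s ∈ B, l ≤ 20 * dist s p)
    (hnear : ∀ s ∈ B, ∀ p' ∈ P, dist s p ≤ dist s p') (hWn : ∀ w ∈ W, ‖w‖ = 1)
    (hW : ∀ u : EuclideanSpace ℝ (Fin 2), ‖u‖ = 1 → ∃ w ∈ W, dist u w < 1 / 40) :
    B.card ≤ 40 * W.card := by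
  classical
  have hcost := h.cost_le_of_exchange hBS (N := insert p (W.image fun w => p + (2 * l) • w)) (by
    intro x s hs hsx
    by_cases hx0 : dist p x ≤ r
    · exact ⟨p, by simp, hx0⟩
    have hxp : x - p ≠ 0 := by
      rintro h0
      rw [sub_eq_zero.1 h0, dist_self] at hx0
      exact hx0 hr.le
    obtain ⟨w, hw, hd⟩ := hW (‖x - p‖⁻¹ • (x - p)) (norm_smul_inv_norm (𝕜 := ℝ) hxp)
    refine ⟨p + (2 * l) • w, by simpa using Or.inr (Or.inr ⟨w, hw, rfl⟩), ?_⟩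
    rw [dist_comm, dist_eq_norm, ← sub_sub]
    rw [dist_comm, dist_eq_norm, not_le] at hx0
    refine norm_sub_two_mul_smul_le hl.le hlr (hWn w hw) hx0 ?_ (dist_eq_norm _ w ▸ hd.le)
    rw [← dist_eq_norm]
    linarith [dist_triangle x s p, dist_comm x s, hub s hs])
  have hN := cost_insert_image_le hp W (fun w => p + (2 * l) • w) (by positivity : 0 ≤ 2 * l)
    fun w hw => by simp [norm_smul, hWn w hw, abs_of_pos hl]
  have hB : B.card * (l / 20) ≤ cost P B := by
    rw [← nsmul_eq_mul]
    refine Finset.card_nsmul_le_sum _ _ _ fun s hs => ?_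
    rw [infDist_eq_dist_of_nearest hp (hnear s hs)]
    linarith [hlb s hs]
  have : l * B.card ≤ l * (40 * W.card) := by linarith
  exact_mod_cast le_of_mul_le_mul_left this hl

theorem stmt_8 :
    ∃ C : ℕ, ∀ (r : ℝ), 0 < r →
      ∀ (P : Finset (EuclideanSpace ℝ (Fin 2))), P.Nonempty →
      ∀ (T : Set (EuclideanSpace ℝ (Fin 2)))
        (S : Finset (EuclideanSpace ℝ (Fin 2))), Optimal r P T S →
      ∀ p ∈ P,
        {s : EuclideanSpace ℝ (Fin 2) | s ∈ S ∧ dist s p ≤ r / 2 ∧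
            ∀ p' ∈ P, dist s p ≤ dist s p'}.ncard ≤ C := by
  classical
  obtain ⟨W', hW's, hW'f, hW'⟩ := (isCompact_sphere (0 : EuclideanSpace ℝ (Fin 2)) 1).finite_cover_balls
    (show (0 : ℝ) < 1 / 40 by norm_num)
  lift W' to Finset (EuclideanSpace ℝ (Fin 2)) using hW'f with W
  have hWn : ∀ w ∈ W, ‖w‖ = 1 := fun w hw => by simpa using hW's hw
  have hW : ∀ u : EuclideanSpace ℝ (Fin 2), ‖u‖ = 1 → ∃ w ∈ W, dist u w < 1 / 40 := fun u hu => by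
    simpa using hW' (show u ∈ Metric.sphere 0 1 by simpa using hu)
  refine ⟨40 * W.card * W.card + 1, fun r hr P _ T S h p hp => ?_⟩
  let A := S.filter fun s => dist s p ≤ r / 2 ∧ ∀ p' ∈ P, dist s p ≤ dist s p'
  have hA : {s : EuclideanSpace ℝ (Fin 2) | s ∈ S ∧ dist s p ≤ r / 2 ∧
      ∀ p' ∈ P, dist s p ≤ dist s p'} = A := by
    ext; simp [A]
  rw [hA, Set.ncard_coe_finset]
  have hdir : ∀ s ∈ A.erase p, ∃ w ∈ W, dist (‖s - p‖⁻¹ • (s - p)) w < 1 / 40 := fun s hs =>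
    hW _ (norm_smul_inv_norm (𝕜 := ℝ) (sub_ne_zero.2 (Finset.ne_of_mem_erase hs)))
  choose! f hfW hf using hdir
  have hfib : ∀ w ∈ W, ((A.erase p).filter fun s => f s = w).card ≤ 40 * W.card := by
    intro w hw
    obtain hB | hB := ((A.erase p).filter fun s => f s = w).eq_empty_or_nonempty
    · simp [hB]
    obtain ⟨s₁, hs₁, hmax⟩ := Finset.exists_max_image _ (fun s => dist s p) hB
    have hmem : ∀ s ∈ (A.erase p).filter fun s => f s = w, s ≠ p ∧ s ∈ S ∧ dist s p ≤ r / 2 ∧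
        (∀ p' ∈ P, dist s p ≤ dist s p') ∧ dist (‖s - p‖⁻¹ • (s - p)) w < 1 / 40 := by
      intro s hs
      obtain ⟨hsA, rfl⟩ := Finset.mem_filter.1 hs
      obtain ⟨hsp, hsA'⟩ := Finset.mem_erase.1 hsA
      obtain ⟨hsS, hsr, hsn⟩ := Finset.mem_filter.1 hsA'
      exact ⟨hsp, hsS, hsr, hsn, hf s hsA⟩
    obtain ⟨h1p, h1S, h1r, -, h1d⟩ := hmem s₁ hs₁
    refine h.card_le_of_comparable hr hp (fun s hs => (hmem s hs).2.1) (dist_pos.2 h1p) h1r hmax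
      (fun s hs => ?_) (fun s hs => (hmem s hs).2.2.2.1) hWn hW
    obtain ⟨hsp, hsS, -, hsn, hsd⟩ := hmem s hs
    refine (h.dist_lt_of_direction_close hr hp h1S hsS h1r hsp h1p hsn ?_).le
    linarith [dist_triangle_right (‖s₁ - p‖⁻¹ • (s₁ - p)) (‖s - p‖⁻¹ • (s - p)) w]
  have := Finset.card_le_mul_card_image_of_maps_to hfW (40 * W.card) hfib
  have := Finset.pred_card_le_card_erase (s := A) (a := p)
  omega
end

section
/- There exists a constant C ∈ ℕ (independent of r, P, T, S and the square) such that the following holds: if S is an optimal solution and k = |P| is the number of stations, then for every axis-aligned closed square q of side length r/√2, the number of sensors of S lying in q is at most C·k. -/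
theorem Optimal.cost_le_of_covers {r : ℝ} {P : Finset (EuclideanSpace ℝ (Fin 2))}
    {T : Set (EuclideanSpace ℝ (Fin 2))} {S A B : Finset (EuclideanSpace ℝ (Fin 2))}
    (hS : Optimal r P T S) (hA : A ⊆ S)
    (hcov : ∀ t, (∃ s ∈ A, dist s t ≤ r) → (∀ s ∈ S \ A, r < dist s t) →
      ∃ s ∈ B, dist s t ≤ r) :
    cost P A ≤ cost P B := by
  classical
  have h1 : Covers r T (S \ A ∪ B) := by
    intro t ht
    by_cases h : ∃ s ∈ S \ A, dist s t ≤ r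
    · obtain ⟨s, hs, hst⟩ := h
      exact ⟨s, Finset.mem_union_left _ hs, hst⟩
    · push Not at h
      obtain ⟨s, hs, hst⟩ := hS.1 t ht
      have hsA : s ∈ A := by
        by_contra hsA
        exact absurd hst (not_le.2 (h s (Finset.mem_sdiff.2 ⟨hs, hsA⟩)))
      obtain ⟨s', hs', hst'⟩ := hcov t ⟨s, hsA, hst⟩ h
      exact ⟨s', Finset.mem_union_right _ hs', hst'⟩
  have h2 := hS.2 _ h1
  have h3 : cost P (S \ A) + cost P A = cost P S := Finset.sum_sdiff hA
  have h4 : cost P (S \ A ∪ B) + cost P (S \ A ∩ B) = cost P (S \ A) + cost P B :=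
    Finset.sum_union_inter
  have h5 : 0 ≤ cost P (S \ A ∩ B) := Finset.sum_nonneg fun _ _ => Metric.infDist_nonneg
  linarith

/-- The points of the disk of radius `r` about `p`, slightly enlarged, are covered by `p` and four
sensors near `p`. -/
theorem exists_cheap_cover {r d : ℝ} (hd : 0 ≤ d) (hdr : d ≤ r / 5)
    {P : Finset (EuclideanSpace ℝ (Fin 2))} {p : EuclideanSpace ℝ (Fin 2)} (hp : p ∈ P) :
    ∃ B : Finset (EuclideanSpace ℝ (Fin 2)), cost P B ≤ 10 * d ∧
      ∀ t, dist p t ^ 2 ≤ r ^ 2 + 2 * r * d → ∃ s ∈ B, dist s t ≤ r := by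
  classical
  refine ⟨{p, p + !₂[2 * d, 0], p + !₂[-(2 * d), 0], p + !₂[0, 2 * d], p + !₂[0, -(2 * d)]},
    ?_, ?_⟩
  · have hle : ∀ v : EuclideanSpace ℝ (Fin 2), ‖v‖ ≤ 2 * d →
        Metric.infDist (p + v) (P : Set (EuclideanSpace ℝ (Fin 2))) ≤ 2 * d := by
      intro v hv
      refine (Metric.infDist_le_dist_of_mem (Finset.mem_coe.2 hp)).trans ?_
      simpa [dist_eq_norm] using hv
    have hsq : √((2 * d) ^ 2) = 2 * d := Real.sqrt_sq (by linarith)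
    have hcard := @Finset.card_le_five _ _ p (p + !₂[2 * d, 0]) (p + !₂[-(2 * d), 0])
      (p + !₂[0, 2 * d]) (p + !₂[0, -(2 * d)])
    refine (Finset.sum_le_card_nsmul _ _ (2 * d) ?_).trans ?_
    · intro s hs
      simp only [Finset.mem_insert, Finset.mem_singleton] at hs
      rcases hs with rfl | rfl | rfl | rfl | rfl
      · simpa using hle 0 (by simpa using hd)
      all_goals
        apply hle
        rw [EuclideanSpace.norm_eq]
        simp [Fin.sum_univ_two, hsq]
    · rw [nsmul_eq_mul]
      have : ((Finset.card {p, p + !₂[2 * d, 0], p + !₂[-(2 * d), 0], p + !₂[0, 2 * d],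
        p + !₂[0, -(2 * d)]} : ℕ) : ℝ) ≤ 5 := by exact_mod_cast hcard
      nlinarith
  · intro t ht
    have hr : 0 ≤ r := by linarith
    by_cases hpt : dist p t ≤ r
    · exact ⟨p, by simp, hpt⟩
    push Not at hpt
    have hsq : r ^ 2 < dist p t ^ 2 := by nlinarith
    have hdist : ∀ s : EuclideanSpace ℝ (Fin 2),
        dist s t ^ 2 = (s 0 - t 0) ^ 2 + (s 1 - t 1) ^ 2 := by
      intro s
      rw [EuclideanSpace.dist_eq, Real.sq_sqrt (by positivity)]
      simp [Fin.sum_univ_two, Real.dist_eq]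
    rw [hdist] at ht hsq
    have hfin : ∀ a b : ℝ, (p 0 + a - t 0) ^ 2 + (p 1 + b - t 1) ^ 2 ≤ r ^ 2 →
        dist (p + !₂[a, b]) t ≤ r := by
      intro a b h
      refine le_of_sq_le_sq ?_ hr
      rw [hdist]
      simpa using h
    obtain ⟨x, hx⟩ : ∃ x, x = t 0 - p 0 := ⟨_, rfl⟩
    obtain ⟨y, hy⟩ : ∃ y, y = t 1 - p 1 := ⟨_, rfl⟩
    have ht0 : t 0 = p 0 + x := by linarith
    have ht1 : t 1 = p 1 + y := by linarith
    rw [ht0, ht1] at ht hsq hfin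
    have key : 7 / 10 * r ≤ |x| ∨ 7 / 10 * r ≤ |y| := by
      by_contra! h
      have h1 := sq_lt_sq₀ (abs_nonneg x) (by linarith) |>.2 h.1
      have h2 := sq_lt_sq₀ (abs_nonneg y) (by linarith) |>.2 h.2
      rw [sq_abs] at h1 h2
      nlinarith
    have hdd : 0 ≤ d * (r / 5 - d) := mul_nonneg hd (by linarith)
    rcases key with h | h <;> rcases le_abs'.1 h with h | h
    · refine ⟨_, ?_, hfin (-(2 * d)) 0 ?_⟩
      · simp
      · nlinarith [mul_nonneg hd (by linarith : 0 ≤ -(7 / 10 * r) - x)]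
    · refine ⟨_, ?_, hfin (2 * d) 0 ?_⟩
      · simp
      · nlinarith [mul_nonneg hd (by linarith : 0 ≤ x - 7 / 10 * r)]
    · refine ⟨_, ?_, hfin 0 (-(2 * d)) ?_⟩
      · simp
      · nlinarith [mul_nonneg hd (by linarith : 0 ≤ -(7 / 10 * r) - y)]
    · refine ⟨_, ?_, hfin 0 (2 * d) ?_⟩
      · simp
      · nlinarith [mul_nonneg hd (by linarith : 0 ≤ y - 7 / 10 * r)]

/-- If `a` is much shorter than `b` and points in nearly the same direction, then a point in the
disk about `a` but not in the disk about `b` is barely outside the disk about the origin. -/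
theorem norm_sq_le_of_aligned {E : Type*} [NormedAddCommGroup E] [InnerProductSpace ℝ E]
    {r : ℝ} {x a b : E} (ha : 0 < ‖a‖) (hab : 80 * ‖a‖ ≤ ‖b‖) (hb : 80 * ‖b‖ ≤ r)
    (hdir : ‖‖b‖⁻¹ • b - ‖a‖⁻¹ • a‖ ≤ 1 / 80) (hxb : r < ‖x - b‖) (hxa : ‖x - a‖ ≤ r) :
    ‖x‖ ^ 2 ≤ r ^ 2 + 2 * r * (‖a‖ / 20) := by
  have hb0 : 0 < ‖b‖ := by linarith
  have hr : 0 < r := by linarith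
  obtain ⟨β, hβ⟩ : ∃ β, β = inner ℝ x (‖b‖⁻¹ • b) := ⟨_, rfl⟩
  obtain ⟨α, hα⟩ : ∃ α, α = inner ℝ x (‖a‖⁻¹ • a) := ⟨_, rfl⟩
  have hib : inner ℝ x b = ‖b‖ * β := by
    rw [hβ, inner_smul_right]; field_simp
  have hia : inner ℝ x a = ‖a‖ * α := by
    rw [hα, inner_smul_right]; field_simp
  have hx : ‖x‖ ≤ r + ‖a‖ := by
    have := norm_add_le (x - a) a
    rw [sub_add_cancel] at this
    linarith
  have hαβ : α - β ≤ ‖x‖ * (1 / 80) := by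
    have h1 : α - β = inner ℝ x (‖a‖⁻¹ • a - ‖b‖⁻¹ • b) := by rw [inner_sub_right, hα, hβ]
    rw [h1]
    refine (real_inner_le_norm _ _).trans ?_
    rw [norm_sub_rev]
    gcongr
  have e1 : r ^ 2 < ‖x‖ ^ 2 - 2 * (‖b‖ * β) + ‖b‖ ^ 2 := by
    rw [← hib, ← norm_sub_sq_real]
    gcongr
  have e2 : ‖x‖ ^ 2 - 2 * (‖a‖ * α) + ‖a‖ ^ 2 ≤ r ^ 2 := by
    rw [← hia, ← norm_sub_sq_real]
    gcongr
  have e3 : ‖x‖ ^ 2 ≤ (r + ‖a‖) ^ 2 := by gcongr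
  have hβ' : β ≤ r / 40 := by
    have h4 : 2 * (‖b‖ * β) ≤ ‖b‖ * (r / 20) := by
      nlinarith [mul_nonneg hb0.le (by linarith : 0 ≤ r - 80 * ‖b‖),
        mul_nonneg hr.le (by linarith : 0 ≤ ‖b‖ - 80 * ‖a‖),
        mul_nonneg ha.le (by linarith : 0 ≤ ‖b‖ - 80 * ‖a‖)]
    have h5 : ‖b‖ * β ≤ ‖b‖ * (r / 40) := by linarith
    exact le_of_mul_le_mul_left h5 hb0
  have hα' : α ≤ r / 20 := by linarith
  nlinarith [mul_le_mul_of_nonneg_left hα' ha.le]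

theorem exists_card_far_le : ∃ N : ℕ, ∀ (r : ℝ), 0 < r →
    ∀ (P : Finset (EuclideanSpace ℝ (Fin 2))) (T : Set (EuclideanSpace ℝ (Fin 2)))
      (S : Finset (EuclideanSpace ℝ (Fin 2))), Optimal r P T S →
    ∀ A ⊆ S, (∀ s ∈ A, ∀ s' ∈ A, dist s s' ≤ r) →
      (∀ s ∈ A, r ≤ 80 * Metric.infDist s (P : Set (EuclideanSpace ℝ (Fin 2)))) →
      A.card ≤ N := by
  classical
  obtain ⟨F, hF, hFfin, hcov⟩ := finite_cover_balls_of_compact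
    (isCompact_closedBall (0 : EuclideanSpace ℝ (Fin 2)) 2) one_pos
  lift F to Finset (EuclideanSpace ℝ (Fin 2)) using hFfin
  refine ⟨F.card * 161, fun r hr P T S hS A hA hdiam hfar => ?_⟩
  rcases A.eq_empty_or_nonempty with rfl | hne
  · simp
  obtain ⟨s₀, hs₀, hmin⟩ := A.exists_min_image
    (fun s => Metric.infDist s (P : Set (EuclideanSpace ℝ (Fin 2)))) hne
  set D := Metric.infDist s₀ (P : Set (EuclideanSpace ℝ (Fin 2))) with hD
  have hrD := hfar s₀ hs₀
  have hDpos : 0 < D := by linarith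
  have hle : cost P A ≤ cost P (F.image fun f => s₀ + r • f) := by
    refine hS.cost_le_of_covers hA fun t ⟨s, hs, hst⟩ _ => ?_
    have h1 : dist s₀ t ≤ 2 * r := by
      linarith [dist_triangle s₀ s t, hdiam s₀ hs₀ s hs]
    have h2 : r⁻¹ • (t - s₀) ∈ Metric.closedBall (0 : EuclideanSpace ℝ (Fin 2)) 2 := by
      rw [mem_closedBall_zero_iff, norm_smul, norm_inv, Real.norm_of_nonneg hr.le, ← dist_eq_norm,
        dist_comm, inv_mul_le_iff₀ hr]
      linarith
    have h3 := hcov h2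
    simp only [Set.mem_iUnion, Metric.mem_ball, exists_prop] at h3
    obtain ⟨f, hf, hft⟩ := h3
    refine ⟨s₀ + r • f, Finset.mem_image_of_mem _ hf, ?_⟩
    have h4 : s₀ + r • f - t = r • (f - r⁻¹ • (t - s₀)) := by
      rw [smul_sub, smul_inv_smul₀ hr.ne']; abel
    rw [dist_eq_norm, h4, norm_smul, Real.norm_of_nonneg hr.le, ← dist_eq_norm, dist_comm]
    nlinarith
  have hlow : A.card • D ≤ cost P A := Finset.card_nsmul_le_sum _ _ _ hmin
  have hupp : cost P (F.image fun f => s₀ + r • f) ≤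
      (F.image fun f => s₀ + r • f).card • (161 * D) := by
    refine Finset.sum_le_card_nsmul _ _ _ fun s hs => ?_
    obtain ⟨f, hf, rfl⟩ := Finset.mem_image.1 hs
    have h1 : ‖f‖ ≤ 2 := by simpa using hF hf
    have h2 : dist (s₀ + r • f) s₀ ≤ r * 2 := by
      rw [dist_eq_norm, add_sub_cancel_left, norm_smul, Real.norm_of_nonneg hr.le]
      gcongr
    have h3 := Metric.infDist_le_infDist_add_dist (s := (P : Set (EuclideanSpace ℝ (Fin 2))))
      (x := s₀ + r • f) (y := s₀)
    linarith
  have hcard : (F.image fun f => s₀ + r • f).card ≤ F.card := Finset.card_image_le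
  have hcard' : (((F.image fun f => s₀ + r • f).card : ℕ) : ℝ) ≤ F.card := by exact_mod_cast hcard
  rw [nsmul_eq_mul] at hlow hupp
  have h : (A.card : ℝ) * D ≤ (F.card * 161 : ℝ) * D := by nlinarith
  exact_mod_cast le_of_mul_le_mul_right h hDpos

theorem card_sector_le {r : ℝ} {P S A : Finset (EuclideanSpace ℝ (Fin 2))}
    {T : Set (EuclideanSpace ℝ (Fin 2))} (hS : Optimal r P T S) (hA : A ⊆ S)
    {p : EuclideanSpace ℝ (Fin 2)} (hp : p ∈ P) (hpA : p ∉ A)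
    (hnear : ∀ s ∈ A, Metric.infDist s (P : Set (EuclideanSpace ℝ (Fin 2))) = ‖s - p‖)
    (hclose : ∀ s ∈ A, 80 * ‖s - p‖ ≤ r)
    (hdir : ∀ s ∈ A, ∀ s' ∈ A, ‖‖s - p‖⁻¹ • (s - p) - ‖s' - p‖⁻¹ • (s' - p)‖ ≤ 1 / 80) :
    A.card ≤ 880 := by
  classical
  rcases A.eq_empty_or_nonempty with rfl | hne
  · simp
  have hpos : ∀ s ∈ A, 0 < ‖s - p‖ := fun s hs =>
    norm_pos_iff.2 (sub_ne_zero.2 fun h => hpA (h ▸ hs))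
  obtain ⟨b, hb, hmax⟩ := A.exists_max_image (fun s => ‖s - p‖) hne
  have hb0 := hpos b hb
  have hbr := hclose b hb
  have hratio : ∀ a ∈ A, ‖b - p‖ / 80 ≤ ‖a - p‖ := by
    intro a ha
    by_contra! hlt
    have ha0 := hpos a ha
    obtain ⟨B, hBcost, hBcov⟩ := exists_cheap_cover (r := r) (d := ‖a - p‖ / 20)
      (by linarith) (by linarith) hp
    have hle : cost P {a} ≤ cost P B := by
      refine hS.cost_le_of_covers (by simpa using hA ha) fun t ⟨s, hs, hst⟩ hunc => hBcov t ?_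
      obtain rfl := Finset.mem_singleton.1 hs
      have hbt : r < dist b t := by
        refine hunc b (Finset.mem_sdiff.2 ⟨hA hb, ?_⟩)
        rw [Finset.mem_singleton]
        rintro rfl
        linarith
      have := norm_sq_le_of_aligned (r := r) (x := t - p) (a := s - p) (b := b - p) ha0
        (by linarith) hbr (hdir b hb s ha)
        (by rwa [sub_sub_sub_cancel_right, ← dist_eq_norm, dist_comm])
        (by rwa [sub_sub_sub_cancel_right, ← dist_eq_norm, dist_comm])
      rwa [dist_comm, dist_eq_norm]
    have : cost P {a} = ‖a - p‖ := by simp [cost, hnear a ha]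
    linarith
  obtain ⟨B, hBcost, hBcov⟩ := exists_cheap_cover (r := r) (d := 11 / 10 * ‖b - p‖)
    (by linarith) (by linarith) hp
  have hle : cost P A ≤ cost P B := by
    refine hS.cost_le_of_covers hA fun t ⟨s, hs, hst⟩ _ => hBcov t ?_
    have h1 : dist p t ≤ r + ‖b - p‖ := by
      have := dist_triangle p s t
      have h2 := hmax s hs
      rw [← dist_eq_norm, dist_comm] at h2
      linarith
    have h3 : dist p t ^ 2 ≤ (r + ‖b - p‖) ^ 2 := by gcongr
    nlinarith
  have hlow : A.card • (‖b - p‖ / 80) ≤ cost P A :=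
    Finset.card_nsmul_le_sum _ _ _ fun s hs => by rw [hnear s hs]; exact hratio s hs
  rw [nsmul_eq_mul] at hlow
  have h : (A.card : ℝ) * ‖b - p‖ ≤ 880 * ‖b - p‖ := by linarith
  exact_mod_cast le_of_mul_le_mul_right h hb0

theorem exists_card_near_le : ∃ N : ℕ, ∀ (r : ℝ) (P S A : Finset (EuclideanSpace ℝ (Fin 2)))
    (T : Set (EuclideanSpace ℝ (Fin 2))), Optimal r P T S → A ⊆ S → ∀ p ∈ P,
    (∀ s ∈ A, Metric.infDist s (P : Set (EuclideanSpace ℝ (Fin 2))) = ‖s - p‖) →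
    (∀ s ∈ A, 80 * ‖s - p‖ ≤ r) → A.card ≤ N := by
  classical
  obtain ⟨F, -, hFfin, hcov⟩ := finite_cover_balls_of_compact
    (isCompact_sphere (0 : EuclideanSpace ℝ (Fin 2)) 1) (by norm_num : (0 : ℝ) < 1 / 160)
  lift F to Finset (EuclideanSpace ℝ (Fin 2)) using hFfin
  refine ⟨880 * F.card + 1, fun r P S A T hS hA p hp hnear hclose => ?_⟩
  set u : EuclideanSpace ℝ (Fin 2) → EuclideanSpace ℝ (Fin 2) :=
    fun s => ‖s - p‖⁻¹ • (s - p) with hu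
  have hsub : A.erase p ⊆
      F.biUnion fun f => (A.erase p).filter fun s => dist (u s) f < 1 / 160 := by
    intro s hs
    have h0 : ‖s - p‖ ≠ 0 := norm_ne_zero_iff.2 (sub_ne_zero.2 (Finset.ne_of_mem_erase hs))
    have h1 : u s ∈ Metric.sphere (0 : EuclideanSpace ℝ (Fin 2)) 1 := by
      rw [mem_sphere_zero_iff_norm, hu, norm_smul, norm_inv, norm_norm, inv_mul_cancel₀ h0]
    have h2 := hcov h1
    simp only [Set.mem_iUnion, Metric.mem_ball, exists_prop] at h2
    obtain ⟨f, hf, hfs⟩ := h2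
    exact Finset.mem_biUnion.2 ⟨f, hf, Finset.mem_filter.2 ⟨hs, hfs⟩⟩
  have hbound : (A.erase p).card ≤ F.card * 880 := by
    refine (Finset.card_le_card hsub).trans (Finset.card_biUnion_le_card_mul _ _ _ fun f _ => ?_)
    have hmem : ∀ s ∈ (A.erase p).filter (fun s => dist (u s) f < 1 / 160), s ∈ A := fun s hs =>
      Finset.mem_of_mem_erase (Finset.mem_filter.1 hs).1
    refine card_sector_le hS (fun s hs => hA (hmem s hs)) hp (by simp)
      (fun s hs => hnear s (hmem s hs)) (fun s hs => hclose s (hmem s hs)) fun s hs s' hs' => ?_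
    have h1 := (Finset.mem_filter.1 hs).2
    have h2 := (Finset.mem_filter.1 hs').2
    change ‖u s - u s'‖ ≤ 1 / 80
    rw [← dist_eq_norm]
    linarith [dist_triangle_right (u s) (u s') f]
  have := Finset.pred_card_le_card_erase (s := A) (a := p)
  omega

theorem stmt_9 :
    ∃ C : ℕ, ∀ (r : ℝ), 0 < r →
      ∀ (P : Finset (EuclideanSpace ℝ (Fin 2))), P.Nonempty →
      ∀ (T : Set (EuclideanSpace ℝ (Fin 2)))
        (S : Finset (EuclideanSpace ℝ (Fin 2))), Optimal r P T S →
      ∀ x₀ y₀ : ℝ,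
        {s : EuclideanSpace ℝ (Fin 2) | s ∈ S ∧
            s 0 ∈ Set.Icc x₀ (x₀ + r / Real.sqrt 2) ∧
            s 1 ∈ Set.Icc y₀ (y₀ + r / Real.sqrt 2)}.ncard ≤ C * P.card := by
  classical
  obtain ⟨N, hN⟩ := exists_card_far_le
  obtain ⟨M, hM⟩ := exists_card_near_le
  refine ⟨N + M, fun r hr P hP T S hS x₀ y₀ => ?_⟩
  set δ : EuclideanSpace ℝ (Fin 2) → ℝ :=
    fun s => Metric.infDist s (P : Set (EuclideanSpace ℝ (Fin 2))) with hδ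
  set A : Finset (EuclideanSpace ℝ (Fin 2)) := S.filter fun s =>
    s 0 ∈ Set.Icc x₀ (x₀ + r / Real.sqrt 2) ∧ s 1 ∈ Set.Icc y₀ (y₀ + r / Real.sqrt 2) with hA
  have hset : {s : EuclideanSpace ℝ (Fin 2) | s ∈ S ∧
      s 0 ∈ Set.Icc x₀ (x₀ + r / Real.sqrt 2) ∧
      s 1 ∈ Set.Icc y₀ (y₀ + r / Real.sqrt 2)} = (A : Set (EuclideanSpace ℝ (Fin 2))) := by
    ext s; simp [hA]
  rw [hset, Set.ncard_coe_finset]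
  have hAS : A ⊆ S := Finset.filter_subset _ _
  have hfar : (A.filter fun s => r ≤ 80 * δ s).card ≤ N := by
    refine hN r hr P T S hS _ ((Finset.filter_subset _ _).trans hAS) ?_
      fun s hs => (Finset.mem_filter.1 hs).2
    intro s hs s' hs'
    have h := (Finset.mem_filter.1 (Finset.mem_filter.1 hs).1).2
    have h' := (Finset.mem_filter.1 (Finset.mem_filter.1 hs').1).2
    simp only [Set.mem_Icc] at h h'
    have hw : (r / Real.sqrt 2) ^ 2 = r ^ 2 / 2 := by rw [div_pow, Real.sq_sqrt (by norm_num)]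
    have e0 : (s 0 - s' 0) ^ 2 ≤ (r / Real.sqrt 2) ^ 2 :=
      sq_le_sq' (by linarith) (by linarith)
    have e1 : (s 1 - s' 1) ^ 2 ≤ (r / Real.sqrt 2) ^ 2 :=
      sq_le_sq' (by linarith) (by linarith)
    rw [EuclideanSpace.dist_eq]
    refine Real.sqrt_le_iff.2 ⟨hr.le, ?_⟩
    simp only [Fin.sum_univ_two, Real.dist_eq, sq_abs]
    linarith
  have hnear : (A.filter fun s => ¬ r ≤ 80 * δ s).card ≤ P.card * M := by
    have hsub : (A.filter fun s => ¬ r ≤ 80 * δ s) ⊆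
        P.biUnion fun p => A.filter fun s => ¬ r ≤ 80 * δ s ∧ δ s = ‖s - p‖ := by
      intro s hs
      obtain ⟨hsA, hs⟩ := Finset.mem_filter.1 hs
      obtain ⟨p, hp, hps⟩ := P.finite_toSet.isCompact.exists_infDist_eq_dist
        (Finset.coe_nonempty.2 hP) s
      rw [dist_eq_norm] at hps
      exact Finset.mem_biUnion.2 ⟨p, hp, Finset.mem_filter.2 ⟨hsA, hs, hps⟩⟩
    refine (Finset.card_le_card hsub).trans (Finset.card_biUnion_le_card_mul _ _ _ fun p hp => ?_)
    refine hM r P S _ T hS ((Finset.filter_subset _ _).trans hAS) p hp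
      (fun s hs => (Finset.mem_filter.1 hs).2.2) fun s hs => ?_
    obtain ⟨-, h1, h2⟩ := Finset.mem_filter.1 hs
    rw [← h2]
    exact (not_le.1 h1).le
  rw [← Finset.card_filter_add_card_filter_not (s := A) fun s => r ≤ 80 * δ s]
  have hP1 : 1 ≤ P.card := hP.card_pos
  nlinarith
end
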